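/- For any positive integers d_1 ≤ ... ≤ d_n, there exists a (necessarily unique) almost reverse lexicographic monomial ideal J ⊂ K[x_1,...,x_n] such that the Hilbert function of R/J equals the Hilbert function of a complete intersection defined by a regular sequence of forms of degrees d_1,...,d_n, i.e., the function with generating series Π_{i=1}^n (1 − z^{d_i})/(1 − z). -/

import Mathlib

open Finset

/-- Total degree of a monomial (exponent vector). -/
def mdeg {n : ℕ} (α : Fin n →₀ ℕ) : ℕ := α.sum fun _ e => e

/-- A set of exponent vectors is the set of monomials of a monomial ideal. -/
def IsMonIdeal {n : ℕ} (S : Set (Fin n →₀ ℕ)) : Prop :=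
  ∀ α ∈ S, ∀ β : Fin n →₀ ℕ, α + β ∈ S

/-- `α` is a minimal monomial generator of the monomial ideal with monomials `S`. -/
def MinGen {n : ℕ} (S : Set (Fin n →₀ ℕ)) (α : Fin n →₀ ℕ) : Prop :=
  α ∈ S ∧ ∀ β ∈ S, β ≤ α → β = α

/-- Stable monomial ideal (variables ordered `x_1 ≻ ⋯ ≻ x_n`, i.e. index `0` largest). -/
def IsStable {n : ℕ} (S : Set (Fin n →₀ ℕ)) : Prop :=
  ∀ α ∈ S, ∀ m ∈ α.support, (∀ k ∈ α.support, k ≤ m) →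
    ∀ i : Fin n, i < m → α - Finsupp.single m 1 + Finsupp.single i 1 ∈ S

def IsStronglyStable {n : ℕ} (S : Set (Fin n →₀ ℕ)) : Prop :=
  ∀ α ∈ S, ∀ i ∈ α.support, ∀ j : Fin n, j < i →
    α - Finsupp.single i 1 + Finsupp.single j 1 ∈ S

/-- `drlLT α β` : `α` is smaller than `β` in degrevlex with `x_1 ≻ ⋯ ≻ x_n`. -/
def drlLT {n : ℕ} (α β : Fin n →₀ ℕ) : Prop :=
  mdeg α < mdeg β ∨ (mdeg α = mdeg β ∧ ∃ i : Fin n, β i < α i ∧ ∀ j : Fin n, i < j → α j = β j)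

def IsAlmostRevLex {n : ℕ} (S : Set (Fin n →₀ ℕ)) : Prop :=
  IsMonIdeal S ∧ ∀ α, MinGen S α → ∀ β : Fin n →₀ ℕ, mdeg β = mdeg α → drlLT α β → β ∈ S

/-- Combinatorial Hilbert function of `R/J`: number of degree-`t` monomials outside `S`. -/
noncomputable def hilbC {n : ℕ} (S : Set (Fin n →₀ ℕ)) (t : ℕ) : ℕ :=
  {α : Fin n →₀ ℕ | mdeg α = t ∧ α ∉ S}.ncard

/-- `fdiff H s t` is `Δ^s H (t)` with the convention `Δ^s H (0) = 1` for `s ≥ 1`. -/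
def fdiff (H : ℕ → ℕ) : ℕ → ℕ → ℤ
  | 0, t => H t
  | _+1, 0 => 1
  | s+1, t+1 => fdiff H s (t+1) - fdiff H s t

open PowerSeries

/-! ### Numerical part -/

/-- Families of iterated partial sums whose positive truncations are unimodal. -/
def GoodFam (F : ℕ → ℕ → ℤ) : Prop :=
  (∀ m, F m 0 = 1) ∧ (∀ m t, F (m+1) (t+1) = F m (t+1) + F (m+1) t) ∧ F 0 1 ≤ 0 ∧
  ∀ m b t, b ≤ t → F m b ≤ 0 → (∀ s ≤ t, 0 < F (m+1) s) → F m t ≤ 0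

lemma goodFam_mono {F : ℕ → ℕ → ℤ} (hF : ∀ m t, F (m+1) (t+1) = F m (t+1) + F (m+1) t)
    (m x y : ℕ) (hxy : x ≤ y) (h : ∀ u, x < u → u ≤ y → 0 < F m u) :
    F (m+1) x + (y - x) ≤ F (m+1) y := by
  induction y, hxy using Nat.le_induction with
  | base => simp
  | succ y hxy ih =>
    have h1 := ih (fun u h1 h2 => h u h1 (by omega))
    have h2 := h (y+1) (by omega) le_rfl
    rw [hF]; push_cast; linarith

lemma goodFam_anti {F : ℕ → ℕ → ℤ} (hF : ∀ m t, F (m+1) (t+1) = F m (t+1) + F (m+1) t)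
    (m x y : ℕ) (hxy : x ≤ y) (h : ∀ u, x < u → u ≤ y → F m u ≤ 0) :
    F (m+1) y ≤ F (m+1) x := by
  induction y, hxy using Nat.le_induction with
  | base => simp
  | succ y hxy ih =>
    have h1 := ih (fun u h1 h2 => h u h1 (by omega))
    have h2 := h (y+1) (by omega) le_rfl
    rw [hF]; linarith

lemma goodFam_step {F : ℕ → ℕ → ℤ} (hF : GoodFam F) (d : ℕ) (hd : 0 < d) :
    GoodFam (fun m t => F m t - if d ≤ t then F m (t - d) else 0) := by
  obtain ⟨h0, h1, h01, hU⟩ := hF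
  refine ⟨?_, ?_, ?_, ?_⟩
  · intro m; simp [h0, hd.ne']
  · intro m t
    simp only [h1]
    by_cases hdt : d ≤ t
    · rw [if_pos hdt, if_pos (by omega), if_pos (by omega), show t + 1 - d = (t - d) + 1 by omega,
        h1]; ring
    · by_cases hdt' : d ≤ t + 1
      · rw [if_neg hdt, if_pos hdt', if_pos hdt', show t + 1 - d = 0 by omega, h0, h0]; ring
      · simp [hdt, hdt']
  · show F 0 1 - (if d ≤ 1 then F 0 (1 - d) else 0) ≤ 0
    split_ifs with h
    · rw [show 1 - d = 0 by omega, h0]; linarith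
    · linarith
  · intro m b t hbt hb hpos
    simp only at hb hpos ⊢
    have hpos' : ∀ s ≤ t, 0 < F (m+1) s := by
      intro s
      induction s using Nat.strong_induction_on with
      | _ s ih =>
        intro hs
        have h2 := hpos s hs
        split_ifs at h2 with h3
        · have := ih (s - d) (by omega) (by omega)
          linarith
        · linarith
    by_cases hA : ∀ s ≤ t, 0 < F m s
    · have hdb : d ≤ b := by
        by_contra hh
        rw [if_neg hh] at hb
        have := hA b hbt
        linarith
      rw [if_pos hdb] at hb
      rw [if_pos (by omega)]
      cases m with
      | zero => have := hA 1 (by omega); linarith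
      | succ k =>
        have hex : ∃ c, b - d < c ∧ c ≤ b ∧ F k c ≤ 0 := by
          by_contra hcon
          push Not at hcon
          have := goodFam_mono h1 k (b - d) b (by omega) hcon
          have h5 : ((b - d : ℕ) : ℤ) < b := by omega
          linarith
        classical
        obtain ⟨c, ⟨hc1, hc2, hc3⟩, hmin⟩ : ∃ c, (b - d < c ∧ c ≤ b ∧ F k c ≤ 0) ∧
            ∀ c' < c, ¬ (b - d < c' ∧ c' ≤ b ∧ F k c' ≤ 0) :=
          ⟨Nat.find hex, Nat.find_spec hex, fun c' h => Nat.find_min hex h⟩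
        have hneg : ∀ u, c ≤ u → u ≤ t → F k u ≤ 0 := fun u hu hut =>
          hU k c u hu hc3 (fun s hs => hA s (by omega))
        by_cases hcase : c ≤ t - d + 1
        · have := goodFam_anti h1 k (t - d) t (by omega) (fun u h2 h3 => hneg u (by omega) h3)
          linarith
        · have e1 := goodFam_anti h1 k b t (by omega) (fun u h2 h3 => hneg u (by omega) h3)
          have e2 := goodFam_mono h1 k (b - d) (t - d) (by omega) (fun u h2 h3 => by
            by_contra hh
            exact hmin u (by omega) ⟨h2, by omega, by linarith⟩)
          have h5 : ((b - d : ℕ) : ℤ) ≤ ((t - d : ℕ) : ℤ) := by omega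
          linarith
    · push Not at hA
      obtain ⟨a, hat, ha⟩ := hA
      have hpt := hU m a t hat ha hpos'
      split_ifs with hdt
      · by_contra hcon
        have hneg : F m (t - d) ≤ 0 := by linarith
        have := goodFam_anti h1 m (t - d) t (by omega) (fun u h2 h3 =>
          hU m (t - d) u (by omega) hneg (fun s hs => hpos' s (by omega)))
        have h6 := hpos t le_rfl
        rw [if_pos hdt] at h6
        linarith
      · linarith

lemma coeff_mk_one_mul_succ (Q : PowerSeries ℤ) (t : ℕ) :
    coeff (t+1) (Q * PowerSeries.mk 1) = coeff (t+1) Q + coeff t (Q * PowerSeries.mk 1) := by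
  have h : Q * PowerSeries.mk 1 = Q + Q * PowerSeries.mk 1 * X := by
    have := PowerSeries.mk_one_mul_one_sub_eq_one ℤ
    linear_combination Q * this
  conv_lhs => rw [h]
  rw [map_add, PowerSeries.coeff_succ_mul_X]

lemma goodFam_prod (l : List ℕ) (hl : ∀ d ∈ l, 0 < d) :
    GoodFam (fun m t => coeff t ((l.map fun d => (1 - X ^ d : PowerSeries ℤ)).prod *
      (PowerSeries.mk 1) ^ m)) := by
  induction l with
  | nil =>
    have key : ∀ m t, 0 < coeff t ((PowerSeries.mk 1 : PowerSeries ℤ) ^ (m+1)) := by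
      intro m
      induction m with
      | zero => intro t; simp
      | succ m ih =>
        intro t
        induction t with
        | zero => simp [PowerSeries.coeff_zero_eq_constantCoeff]; 
        | succ t iht =>
          rw [pow_succ, coeff_mk_one_mul_succ]
          rw [pow_succ] at iht
          have := ih (t+1)
          linarith
    refine ⟨?_, ?_, ?_, ?_⟩
    · intro m; simp [PowerSeries.coeff_zero_eq_constantCoeff]
    · intro m t
      simp only [pow_succ, ← mul_assoc]
      exact coeff_mk_one_mul_succ _ _
    · simp [PowerSeries.coeff_one]
    · intro m b t hbt hb _
      cases m with
      | zero =>
        have : b ≠ 0 := by rintro rfl; simp at hb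
        simp [PowerSeries.coeff_one]
        rw [if_neg (by omega)]
      | succ m =>
        have := key m b
        simp at hb
        linarith
  | cons d l ih =>
    have := goodFam_step (ih (fun x hx => hl x (List.mem_cons_of_mem _ hx))) d
      (hl d List.mem_cons_self)
    convert this using 3 with m t
    rw [List.map_cons, List.prod_cons, mul_assoc, sub_mul, one_mul, map_sub,
      PowerSeries.coeff_X_pow_mul']

/-- Nonnegative coefficients, vanishing from the first zero on. -/
def ZeroPersist (P : PowerSeries ℤ) : Prop :=
  (∀ t, 0 ≤ coeff t P) ∧ ∀ t, coeff t P = 0 → coeff (t+1) P = 0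

lemma zeroPersist_mul {P Q : PowerSeries ℤ} (hP : ZeroPersist P) (hQ : ZeroPersist Q) :
    ZeroPersist (P * Q) := by
  refine ⟨fun t => ?_, fun t ht => ?_⟩
  · rw [PowerSeries.coeff_mul]
    exact Finset.sum_nonneg fun p _ => mul_nonneg (hP.1 _) (hQ.1 _)
  · rw [PowerSeries.coeff_mul] at ht ⊢
    rw [Finset.sum_eq_zero_iff_of_nonneg (fun p _ => mul_nonneg (hP.1 _) (hQ.1 _))] at ht
    refine Finset.sum_eq_zero ?_
    rintro ⟨i, j⟩ hij
    rw [Finset.HasAntidiagonal.mem_antidiagonal] at hij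
    simp only at hij ⊢
    cases i with
    | zero =>
      have h1 := ht (0, t) (by simp)
      obtain rfl : j = t + 1 := by omega
      rcases mul_eq_zero.1 h1 with h | h
      · simp [h]
      · simp [hQ.2 _ h]
    | succ i =>
      have h1 := ht (i, j) (by simp; omega)
      rcases mul_eq_zero.1 h1 with h | h
      · simp [hP.2 _ h]
      · simp only at h; simp [h]

lemma coeff_geom (d t : ℕ) :
    coeff t (∑ j ∈ Finset.range d, (X : PowerSeries ℤ) ^ j) = if t < d then 1 else 0 := by
  simp [PowerSeries.coeff_X_pow]

lemma zeroPersist_geom (d : ℕ) : ZeroPersist (∑ j ∈ Finset.range d, (X : PowerSeries ℤ) ^ j) := by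
  refine ⟨fun t => ?_, fun t ht => ?_⟩
  · rw [coeff_geom]; split_ifs <;> simp
  · rw [coeff_geom] at ht ⊢
    have h : ¬ t < d := fun h => by simp [h] at ht
    rw [if_neg (by omega)]

lemma numeric {n : ℕ} (d : Fin n → ℕ) (hd : ∀ i, 0 < d i) (H : ℕ → ℕ)
    (hH : (PowerSeries.mk fun t => (H t : ℤ)) * (1 - PowerSeries.X) ^ n =
      ∏ i : Fin n, (1 - PowerSeries.X ^ d i)) :
    ∃ F : ℕ → ℕ → ℤ, GoodFam F ∧ (∀ t, F n t = H t) ∧ ∀ t, H t = 0 → H (t+1) = 0 := by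
  refine ⟨_, goodFam_prod (List.ofFn d) ?_, ?_, ?_⟩
  · intro x hx
    obtain ⟨i, rfl⟩ := (List.mem_ofFn' _ _).1 hx
    exact hd i
  · intro t
    rw [List.map_ofFn, List.prod_ofFn]
    simp only [Function.comp]
    rw [← hH, mul_assoc, ← mul_pow, mul_comm (1 - X), PowerSeries.mk_one_mul_one_sub_eq_one]
    simp
  · have h1 : (PowerSeries.mk fun t => (H t : ℤ)) =
        ∏ i : Fin n, ∑ j ∈ Finset.range (d i), (X : PowerSeries ℤ) ^ j := by
      have hne : (1 - X : PowerSeries ℤ) ^ n ≠ 0 := by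
        apply pow_ne_zero
        intro h
        have := PowerSeries.mk_one_mul_one_sub_eq_one ℤ
        rw [h] at this; simp at this
      apply mul_right_cancel₀ hne
      rw [hH]
      have : (1 - X : PowerSeries ℤ) ^ n = ∏ i : Fin n, (1 - X) := by simp
      rw [this, ← Finset.prod_mul_distrib]
      exact Finset.prod_congr rfl fun i _ => (geom_sum_mul_neg _ _).symm
    have h2 : ZeroPersist (PowerSeries.mk fun t => (H t : ℤ)) := by
      rw [h1]
      refine Finset.prod_induction _ ZeroPersist (fun _ _ => zeroPersist_mul) ?_
        (fun i _ => zeroPersist_geom _)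
      have := zeroPersist_geom 1
      simpa using this
    intro t ht
    have := h2.2 t
    simp only [PowerSeries.coeff_mk] at this
    exact_mod_cast this (by exact_mod_cast ht)

/-- Truncation at the first nonpositive value. -/
noncomputable def truncPos (f : ℕ → ℤ) (t : ℕ) : ℕ :=
  open Classical in if ∀ s ≤ t, 0 < f s then (f t).toNat else 0

lemma truncPos_step {F : ℕ → ℕ → ℤ} (hF : GoodFam F) (m : ℕ) :
    truncPos (F (m+1)) 0 = truncPos (F m) 0 ∧ ∀ t,
      truncPos (F (m+1)) (t+1) = truncPos (F m) (t+1) + truncPos (F (m+1)) t ∨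
      (truncPos (F m) (t+1) = 0 ∧ truncPos (F (m+1)) (t+1) ≤ truncPos (F (m+1)) t) := by
  obtain ⟨h0, h1, h01, hU⟩ := hF
  refine ⟨by simp [truncPos, h0], fun t => ?_⟩
  by_cases hA : ∀ s ≤ t + 1, 0 < F m s
  · left
    have hp : ∀ s ≤ t + 1, 0 < F (m+1) s := by
      intro s hs
      have := goodFam_mono h1 m 0 s (by omega) (fun u _ hu => hA u (by omega))
      rw [h0] at this
      push_cast at this
      omega
    unfold truncPos
    rw [if_pos hA, if_pos hp, if_pos (fun s hs => hp s (by omega))]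
    have := h1 m t
    have := hp t (by omega)
    have := hA (t+1) le_rfl
    omega
  · right
    refine ⟨by unfold truncPos; rw [if_neg hA], ?_⟩
    by_cases hB : ∀ s ≤ t + 1, 0 < F (m+1) s
    · unfold truncPos
      rw [if_pos hB, if_pos (fun s hs => hB s (by omega))]
      push Not at hA
      obtain ⟨b, hb, hb'⟩ := hA
      have := hU m b (t+1) hb hb' hB
      have := h1 m t
      omega
    · conv_lhs => unfold truncPos
      rw [if_neg hB]; simp

/-! ### Combinatorial part -/

lemma mdeg_eq_sum {n : ℕ} (α : Fin n →₀ ℕ) : mdeg α = ∑ i, α i := by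
  unfold mdeg
  exact Finsupp.sum_fintype _ _ (fun _ => rfl)

lemma mdeg_add {n : ℕ} (α β : Fin n →₀ ℕ) : mdeg (α + β) = mdeg α + mdeg β := by
  simp [mdeg_eq_sum, Finset.sum_add_distrib]

lemma mdeg_single {n : ℕ} (i : Fin n) : mdeg (Finsupp.single i 1) = 1 := by
  simp [mdeg]

lemma le_mdeg {n : ℕ} (α : Fin n →₀ ℕ) (i : Fin n) : α i ≤ mdeg α := by
  rw [mdeg_eq_sum]
  exact Finset.single_le_sum (f := fun i => α i) (fun _ _ => Nat.zero_le _) (Finset.mem_univ i)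

lemma finite_mdeg (n t : ℕ) : {α : Fin n →₀ ℕ | mdeg α = t}.Finite := by
  refine (Set.finite_Iic (Finsupp.equivFunOnFinite.symm (fun _ : Fin n => t))).subset ?_
  intro α hα i
  have := le_mdeg α i
  rw [Set.mem_ofPred_eq] at hα
  simp; omega

lemma eq_single_add {n : ℕ} {α : Fin n →₀ ℕ} {i : Fin n} (h : 0 < α i) :
    ∃ β, α = β + Finsupp.single i 1 := by
  refine ⟨α - Finsupp.single i 1, (tsub_add_cancel_of_le ?_).symm⟩
  intro j
  by_cases hj : i = j
  · subst hj; simpa [Nat.one_le_iff_ne_zero, Nat.pos_iff_ne_zero] using h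
  · simp [Finsupp.single_apply, hj]

/-- A linear-order key for degrevlex. -/
def revKey {n : ℕ} (α : Fin n →₀ ℕ) : Lex (Fin n → ℕ) := toLex fun i => α i.rev

lemma revKey_inj {n : ℕ} {α β : Fin n →₀ ℕ} (h : revKey α = revKey β) : α = β := by
  ext i
  have h1 : (fun i : Fin n => α i.rev) = fun i => β i.rev := h
  have := congrFun h1 i.rev
  simpa using this

lemma revKey_lt {n : ℕ} {α β : Fin n →₀ ℕ} : revKey β < revKey α ↔
    ∃ i : Fin n, β i < α i ∧ ∀ j : Fin n, i < j → α j = β j := by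
  constructor
  · rintro ⟨i, h1, h2⟩
    refine ⟨i.rev, h2, fun j hj => ?_⟩
    have h3 := h1 j.rev (by show j.rev < i; rw [← Fin.rev_lt_rev]; simpa using hj)
    have h4 : β j.rev.rev = α j.rev.rev := h3
    simpa using h4.symm
  · rintro ⟨i, h1, h2⟩
    refine ⟨i.rev, fun j hj => ?_, ?_⟩
    · exact (h2 j.rev (by rw [← Fin.rev_lt_rev]; simpa using hj)).symm
    · show β i.rev.rev < α i.rev.rev
      simpa using h1

lemma drlLT_iff {n : ℕ} {α β : Fin n →₀ ℕ} (h : mdeg α = mdeg β) :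
    drlLT α β ↔ revKey β < revKey α := by
  rw [revKey_lt]; simp [drlLT, h]

lemma mdeg_lt_of_le {n : ℕ} {α β : Fin n →₀ ℕ} (h : α ≤ β) (hne : α ≠ β) : mdeg α < mdeg β := by
  obtain ⟨γ, rfl⟩ := exists_add_of_le h
  rw [mdeg_add]
  by_contra hc
  apply hne
  have : γ = 0 := by
    ext i
    have := le_mdeg γ i
    simp; omega
  simp [this]

lemma almostRevLex_unique_aux {n : ℕ} {S T : Set (Fin n →₀ ℕ)} (hS : IsAlmostRevLex S)
    (hT : IsAlmostRevLex T) (h : ∀ t, hilbC S t = hilbC T t) (t : ℕ)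
    (ih : ∀ α : Fin n →₀ ℕ, mdeg α < t → (α ∈ S ↔ α ∈ T)) (α : Fin n →₀ ℕ) (hα : mdeg α = t)
    (hαS : α ∈ S) : α ∈ T := by
  by_contra hαT
  have hgen : ∀ {S T : Set (Fin n →₀ ℕ)}, IsAlmostRevLex T →
      (∀ α : Fin n →₀ ℕ, mdeg α < t → (α ∈ S ↔ α ∈ T)) → ∀ α : Fin n →₀ ℕ, mdeg α = t →
      α ∈ S → α ∉ T → MinGen S α := by
    intro S T hT ih α hα hαS hαT
    refine ⟨hαS, fun γ hγ hle => ?_⟩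
    by_contra hne
    have h1 := mdeg_lt_of_le hle hne
    have h2 := (ih γ (by omega)).1 hγ
    obtain ⟨δ, rfl⟩ := exists_add_of_le hle
    exact hαT (hT.1 _ h2 δ)
  obtain ⟨β, hβ, hβS, hβT⟩ : ∃ β : Fin n →₀ ℕ, mdeg β = t ∧ β ∉ S ∧ β ∈ T := by
    by_contra hcon
    push Not at hcon
    have hsub : {α : Fin n →₀ ℕ | mdeg α = t ∧ α ∉ S} ⊆ {α : Fin n →₀ ℕ | mdeg α = t ∧ α ∉ T} :=
      fun β hβ => ⟨hβ.1, hcon β hβ.1 hβ.2⟩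
    have heq := Set.eq_of_subset_of_ncard_le hsub (h t).ge
      ((finite_mdeg n t).subset fun x hx => hx.1)
    have : α ∈ {α : Fin n →₀ ℕ | mdeg α = t ∧ α ∉ S} := by rw [heq]; exact ⟨hα, hαT⟩
    exact this.2 hαS
  have hgα := hgen hT ih α hα hαS hαT
  have hgβ := hgen hS (fun α h => (ih α h).symm) β hβ hβT hβS
  rcases lt_trichotomy (revKey α) (revKey β) with hlt | heq | hlt
  · exact hαT (hT.2 β hgβ α (by omega) ((drlLT_iff (by omega)).2 hlt))
  · exact hβS (revKey_inj heq ▸ hαS)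
  · exact hβS (hS.2 α hgα β (by omega) ((drlLT_iff (by omega)).2 hlt))

lemma almostRevLex_unique {n : ℕ} {S T : Set (Fin n →₀ ℕ)} (hS : IsAlmostRevLex S)
    (hT : IsAlmostRevLex T) (h : ∀ t, hilbC S t = hilbC T t) : S = T := by
  have key : ∀ t, ∀ α : Fin n →₀ ℕ, mdeg α = t → (α ∈ S ↔ α ∈ T) := by
    intro t
    induction t using Nat.strong_induction_on with
    | _ t ih =>
      intro α hα
      exact ⟨almostRevLex_unique_aux hS hT h t (fun α h => ih _ h α rfl) α hα,
        almostRevLex_unique_aux hT hS (fun t => (h t).symm) t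
          (fun α h => (ih _ h α rfl).symm) α hα⟩
  ext α
  exact key _ α rfl

/-- The `k` smallest monomials of a finite set. -/
lemma exists_lowest {n : ℕ} (C : Finset (Fin n →₀ ℕ)) (k : ℕ) (hk : k ≤ C.card) :
    ∃ L ⊆ C, L.card = k ∧ ∀ x ∈ L, ∀ y ∈ C, revKey x < revKey y → y ∈ L := by
  induction k with
  | zero => exact ⟨∅, by simp, by simp, by simp⟩
  | succ k ih =>
    obtain ⟨L, hL, hc, hlow⟩ := ih (by omega)
    have hne : (C \ L).Nonempty := by
      rw [← Finset.card_pos, Finset.card_sdiff_of_subset hL]; omega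
    obtain ⟨x, hx, hmax⟩ := Finset.exists_max_image (C \ L) revKey hne
    rw [Finset.mem_sdiff] at hx
    refine ⟨insert x L, Finset.insert_subset hx.1 hL, by rw [Finset.card_insert_of_notMem hx.2, hc],
      ?_⟩
    intro z hz y hy hlt
    rw [Finset.mem_insert] at hz ⊢
    right
    rcases hz with rfl | hz
    · by_contra hyL
      exact absurd (hmax y (Finset.mem_sdiff.2 ⟨hy, hyL⟩)) (not_le.2 hlt)
    · exact hlow z hz y hy hlt

/-- Drop the last variable. -/
noncomputable def ini {m : ℕ} (α : Fin (m+1) →₀ ℕ) : Fin m →₀ ℕ :=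
  Finsupp.equivFunOnFinite.symm fun i => α i.castSucc

/-- Extend by exponent zero in the last variable. -/
noncomputable def ext0 {m : ℕ} (α : Fin m →₀ ℕ) : Fin (m+1) →₀ ℕ :=
  Finsupp.equivFunOnFinite.symm (Fin.snoc (α := fun _ => ℕ) (fun i => α i) 0)

@[simp] lemma ini_apply {m : ℕ} (α : Fin (m+1) →₀ ℕ) (i : Fin m) : ini α i = α i.castSucc := rfl

@[simp] lemma ext0_castSucc {m : ℕ} (α : Fin m →₀ ℕ) (i : Fin m) : ext0 α i.castSucc = α i := by
  simp [ext0]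

@[simp] lemma ext0_last {m : ℕ} (α : Fin m →₀ ℕ) : ext0 α (Fin.last m) = 0 := by
  simp [ext0]

@[simp] lemma ini_ext0 {m : ℕ} (α : Fin m →₀ ℕ) : ini (ext0 α) = α := by
  ext i; simp

lemma ext0_ini {m : ℕ} {α : Fin (m+1) →₀ ℕ} (h : α (Fin.last m) = 0) : ext0 (ini α) = α := by
  ext i
  refine Fin.lastCases ?_ (fun i => ?_) i <;> simp [h]

lemma ini_add {m : ℕ} (α β : Fin (m+1) →₀ ℕ) : ini (α + β) = ini α + ini β := by
  ext i; simp

lemma ini_single_last {m : ℕ} : ini (Finsupp.single (Fin.last m) 1) = 0 := by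
  ext i; simp [Finsupp.single_apply, (Fin.castSucc_lt_last i).ne']

lemma mdeg_ini {m : ℕ} (α : Fin (m+1) →₀ ℕ) : mdeg α = mdeg (ini α) + α (Fin.last m) := by
  simp [mdeg_eq_sum, Fin.sum_univ_castSucc]

lemma mdeg_ext0 {m : ℕ} (α : Fin m →₀ ℕ) : mdeg (ext0 α) = mdeg α := by
  rw [mdeg_ini]; simp

/-- Inductive step: from `m` to `m+1` variables. -/
lemma exists_step {m : ℕ} (S' : Set (Fin m →₀ ℕ)) (hS' : IsAlmostRevLex S') (h : ℕ → ℕ)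
    (h0 : h 0 = hilbC S' 0)
    (hs : ∀ t, h (t+1) = hilbC S' (t+1) + h t ∨ (hilbC S' (t+1) = 0 ∧ h (t+1) ≤ h t)) :
    ∃ S : Set (Fin (m+1) →₀ ℕ), IsAlmostRevLex S ∧ ∀ t, hilbC S t = h t := by
  classical
  set e : Fin (m+1) →₀ ℕ := Finsupp.single (Fin.last m) 1 with he
  have hele : e (Fin.last m) = 1 := by simp [he]
  have hEfin : ∀ t, {β : Fin m →₀ ℕ | mdeg β = t ∧ β ∉ S'}.Finite := fun t =>
    (finite_mdeg m t).subset fun x hx => hx.1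
  have hext_inj : Function.Injective (ext0 : (Fin m →₀ ℕ) → (Fin (m+1) →₀ ℕ)) := fun a b hab => by
    rw [← ini_ext0 a, hab, ini_ext0]
  have hadd_inj : Function.Injective (fun γ : Fin (m+1) →₀ ℕ => γ + e) := fun a b hab =>
    add_right_cancel hab
  let E : ℕ → Finset (Fin (m+1) →₀ ℕ) := fun t => (hEfin t).toFinset.image ext0
  have hEcard : ∀ t, (E t).card = hilbC S' t := by
    intro t
    rw [Finset.card_image_of_injective _ hext_inj, hilbC, Set.ncard_eq_toFinset_card _ (hEfin t)]
  have hEmem : ∀ t α, α ∈ E t ↔ mdeg α = t ∧ α (Fin.last m) = 0 ∧ ini α ∉ S' := by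
    intro t α
    simp only [E, Finset.mem_image, Set.Finite.mem_toFinset, Set.mem_ofPred_eq]
    constructor
    · rintro ⟨β, ⟨h1, h2⟩, rfl⟩
      refine ⟨by rw [mdeg_ext0, h1], by simp, by simpa using h2⟩
    · rintro ⟨h1, h2, h3⟩
      refine ⟨ini α, ⟨?_, h3⟩, ext0_ini h2⟩
      rw [mdeg_ini] at h1; omega
  have hlow : ∀ (k : ℕ) (C : Finset (Fin (m+1) →₀ ℕ)), ∃ L : Finset (Fin (m+1) →₀ ℕ),
      k ≤ C.card → L ⊆ C ∧ L.card = k ∧ ∀ x ∈ L, ∀ y ∈ C, revKey x < revKey y → y ∈ L := by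
    intro k C
    by_cases hk : k ≤ C.card
    · obtain ⟨L, h1, h2, h3⟩ := exists_lowest C k hk
      exact ⟨L, fun _ => ⟨h1, h2, h3⟩⟩
    · exact ⟨∅, fun h => absurd h hk⟩
  choose low hlow using hlow
  let Out : ℕ → Finset (Fin (m+1) →₀ ℕ) := fun t =>
    Nat.rec (E 0) (fun t O => low (h (t+1)) (E (t+1) ∪ O.image (fun γ => γ + e))) t
  let C : ℕ → Finset (Fin (m+1) →₀ ℕ) := fun t => E (t+1) ∪ (Out t).image (fun γ => γ + e)
  have hOut0 : Out 0 = E 0 := rfl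
  have hOutS : ∀ t, Out (t+1) = low (h (t+1)) (C t) := fun t => rfl
  have hCmem : ∀ t α, α ∈ C t ↔ α ∈ E (t+1) ∨ ∃ γ ∈ Out t, γ + e = α := by
    intro t α; simp [C]
  have hCcard : ∀ t, (C t).card = hilbC S' (t+1) + (Out t).card := by
    intro t
    rw [Finset.card_union_of_disjoint, hEcard, Finset.card_image_of_injective _ hadd_inj]
    rw [Finset.disjoint_left]
    intro α hα hα'
    rw [hEmem] at hα
    obtain ⟨γ, _, rfl⟩ := Finset.mem_image.1 hα'
    have := hα.2.1
    simp [hele] at this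
  clear_value C Out E
  have hcard : ∀ t, (Out t).card = h t := by
    intro t
    induction t with
    | zero => rw [hOut0, hEcard, h0]
    | succ t ih =>
      rw [hOutS]
      refine (hlow (h (t+1)) (C t) ?_).2.1
      rw [hCcard, ih]
      rcases hs t with h1 | h1 <;> omega
  have hle : ∀ t, h (t+1) ≤ (C t).card := by
    intro t
    rw [hCcard, hcard]
    rcases hs t with h1 | h1 <;> omega
  have hsub : ∀ t, Out (t+1) ⊆ C t := fun t => by rw [hOutS]; exact (hlow _ _ (hle t)).1
  have hlw : ∀ t, ∀ x ∈ Out (t+1), ∀ y ∈ C t, revKey x < revKey y → y ∈ Out (t+1) :=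
    fun t => by rw [hOutS]; exact (hlow _ _ (hle t)).2.2
  have hall : ∀ t α, α ∈ E (t+1) → C t = Out (t+1) := by
    intro t α hα
    symm
    apply Finset.eq_of_subset_of_card_le (hsub t)
    rw [hCcard, hcard, hcard]
    have hpos : 0 < hilbC S' (t+1) := by
      rw [← hEcard]; exact Finset.card_pos.2 ⟨α, hα⟩
    rcases hs t with h1 | h1 <;> omega
  have hEOut : ∀ t α, α ∈ E t → α ∈ Out t := by
    intro t α hα
    cases t with
    | zero => rw [hOut0]; exact hα
    | succ t => rw [← hall t α hα, hCmem]; exact Or.inl hα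
  have hinv : ∀ t, ∀ α ∈ Out t, mdeg α = t ∧ ini α ∉ S' := by
    intro t
    induction t with
    | zero => intro α hα; rw [hOut0] at hα; have := (hEmem 0 α).1 hα; exact ⟨this.1, this.2.2⟩
    | succ t ih =>
      intro α hα
      rcases (hCmem t α).1 (hsub t hα) with h1 | ⟨γ, hγ, rfl⟩
      · have := (hEmem _ α).1 h1; exact ⟨this.1, this.2.2⟩
      · have := ih γ hγ
        refine ⟨by rw [mdeg_add, this.1, he, mdeg_single], ?_⟩
        rw [ini_add, ini_single_last, add_zero]; exact this.2
  have hlastdiv : ∀ t γ, γ + e ∈ Out (t+1) → γ ∈ Out t := by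
    intro t γ hγ
    rcases (hCmem t _).1 (hsub t hγ) with h1 | ⟨δ, hδ, h1⟩
    · have := ((hEmem _ _).1 h1).2.1
      simp [hele] at this
    · rwa [← hadd_inj h1]
  have hdiv : ∀ t γ (i : Fin (m+1)), γ + Finsupp.single i 1 ∈ Out (t+1) → γ ∈ Out t := by
    intro t
    induction t with
    | zero =>
      intro γ i hγ
      rcases Fin.eq_castSucc_or_eq_last i with ⟨i, rfl⟩ | rfl
      · rcases (hCmem 0 _).1 (hsub 0 hγ) with h1 | ⟨β, hβ, h1⟩
        · rw [hEmem, mdeg_add, mdeg_single, ini_add] at h1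
          apply hEOut
          rw [hEmem]
          exact ⟨by omega, by have := h1.2.1; simp at this; omega, fun hh => h1.2.2 (hS'.1 _ hh _)⟩
        · have h2 := (hinv 0 β hβ).1
          have h3 := le_mdeg β i.castSucc
          have h4 := DFunLike.congr_fun h1 i.castSucc
          simp [he, Finsupp.single_apply, (Fin.castSucc_lt_last i).ne'] at h4
          omega
      · exact hlastdiv 0 γ hγ
    | succ t ih =>
      intro γ i hγ
      rcases Fin.eq_castSucc_or_eq_last i with ⟨i, rfl⟩ | rfl
      · rcases (hCmem _ _).1 (hsub _ hγ) with h1 | ⟨β, hβ, h1⟩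
        · rw [hEmem, mdeg_add, mdeg_single, ini_add] at h1
          apply hEOut
          rw [hEmem]
          exact ⟨by omega, by have := h1.2.1; simp at this; omega, fun hh => h1.2.2 (hS'.1 _ hh _)⟩
        · have h4 := DFunLike.congr_fun h1 i.castSucc
          simp [he, Finsupp.single_apply, (Fin.castSucc_lt_last i).ne'] at h4
          obtain ⟨δ, rfl⟩ := eq_single_add (α := β) (i := i.castSucc) (by omega)
          have hδ := ih δ _ hβ
          have hγδ : γ = δ + e := by
            apply add_right_cancel (b := Finsupp.single i.castSucc 1)
            rw [← h1]; abel
          subst hγδ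
          refine hlw t _ hβ _ ((hCmem _ _).2 (Or.inr ⟨δ, hδ, rfl⟩)) ?_
          rw [revKey_lt]
          refine ⟨Fin.last m, ?_, fun j hj => absurd hj (not_lt.2 (Fin.le_last j))⟩
          simp [hele, Finsupp.single_apply, (Fin.castSucc_lt_last i).ne]
      · exact hlastdiv _ γ hγ
  refine ⟨{α | α ∉ Out (mdeg α)}, ⟨?_, ?_⟩, ?_⟩
  · -- monomial ideal
    have key : ∀ k (β : Fin (m+1) →₀ ℕ), mdeg β = k → ∀ α : Fin (m+1) →₀ ℕ,
        α + β ∈ Out (mdeg (α + β)) → α ∈ Out (mdeg α) := by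
      intro k
      induction k with
      | zero =>
        intro β hβ α hα
        have : β = 0 := by
          ext i
          have := le_mdeg β i
          simp; omega
        simpa [this] using hα
      | succ k ih =>
        intro β hβ α hα
        obtain ⟨i, hi⟩ : ∃ i, 0 < β i := by
          by_contra hcon
          push Not at hcon
          rw [mdeg_eq_sum, Finset.sum_eq_zero (fun i _ => by have := hcon i; omega)] at hβ
          omega
        obtain ⟨γ, rfl⟩ := eq_single_add hi
        rw [mdeg_add, mdeg_single] at hβ
        apply ih γ (by omega)
        apply hdiv _ _ i
        rw [← add_assoc, mdeg_add, mdeg_single] at hα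
        exact hα
    intro α hα β hβ
    exact hα (key _ β rfl α hβ)
  · intro α hα β hdeg hlt hβ
    rw [drlLT_iff hdeg.symm] at hlt
    obtain ⟨hαS, hmin⟩ := hα
    rw [hdeg] at hβ
    rw [Set.mem_ofPred_eq] at hαS
    obtain ⟨s, hsdeg⟩ | hz : (∃ s, mdeg α = s + 1) ∨ mdeg α = 0 := by
      rcases Nat.eq_zero_or_eq_succ_pred (mdeg α) with h1 | h1
      · exact Or.inr h1
      · exact Or.inl ⟨_, h1⟩
    · rw [hsdeg] at hαS hβ
      by_cases hl : 0 < α (Fin.last m)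
      · obtain ⟨γ, rfl⟩ := eq_single_add hl
        rw [mdeg_add, mdeg_single] at hsdeg
        have hγ : γ ∈ Out s := by
          by_contra hγ
          have hd' : mdeg γ = s := by omega
          have := hmin γ (by rw [Set.mem_ofPred_eq, hd']; exact hγ) (by simp)
          have h2 := DFunLike.congr_fun this (Fin.last m)
          simp at h2
        exact hαS (hlw s β hβ _ ((hCmem _ _).2 (Or.inr ⟨γ, hγ, rfl⟩)) hlt)
      · have hl0 : α (Fin.last m) = 0 := by omega
        obtain ⟨i, hi1, hi2⟩ := revKey_lt.1 hlt
        have hβl : β (Fin.last m) = 0 := by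
          rcases Fin.eq_castSucc_or_eq_last i with ⟨i, rfl⟩ | rfl
          · rw [← hi2 _ (Fin.castSucc_lt_last i)]; exact hl0
          · omega
        have hβE : β ∈ E (s+1) := (hEmem _ _).2 ⟨by omega, hβl, (hinv _ _ hβ).2⟩
        have hαS' : ini α ∈ S' := by
          by_contra hcon
          exact hαS (hEOut _ _ ((hEmem _ _).2 ⟨hsdeg, hl0, hcon⟩))
        refine (hinv _ _ hβ).2 (hS'.2 (ini α) ⟨hαS', ?_⟩ (ini β) ?_ ?_)
        · intro γ hγ hγle
          have h1 : ext0 γ ∈ {α | α ∉ Out (mdeg α)} := fun hh => by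
            have := (hinv _ _ hh).2
            rw [ini_ext0] at this
            exact this hγ
          have h2 : ext0 γ ≤ α := by
            intro i
            refine Fin.lastCases ?_ (fun i => ?_) i
            · simp
            · simpa using hγle i
          rw [← hmin _ h1 h2, ini_ext0]
        · have h1 := mdeg_ini α
          have h2 := mdeg_ini β
          omega
        · rw [drlLT_iff (by have h1 := mdeg_ini α; have h2 := mdeg_ini β; omega), revKey_lt]
          rcases Fin.eq_castSucc_or_eq_last i with ⟨i, rfl⟩ | rfl
          · exact ⟨i, hi1, fun j hj => hi2 j.castSucc (by simpa using hj)⟩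
          · omega
    · obtain ⟨i, hi1, hi2⟩ := revKey_lt.1 hlt
      have := le_mdeg α i
      omega
  · intro t
    rw [← hcard, hilbC, ← Set.ncard_coe_finset]
    congr 1
    ext α
    simp only [Set.mem_ofPred_eq, not_not, Finset.mem_coe]
    constructor
    · rintro ⟨rfl, h2⟩; exact h2
    · intro h2
      have := (hinv _ _ h2).1
      exact ⟨this, by rwa [this]⟩

lemma exists_of_goodFam {F : ℕ → ℕ → ℤ} (hF : GoodFam F) (m : ℕ) :
    ∃ S : Set (Fin m →₀ ℕ), IsAlmostRevLex S ∧ ∀ t, hilbC S t = truncPos (F m) t := by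
  induction m with
  | zero =>
    refine ⟨∅, ⟨fun α hα => absurd hα (Set.notMem_empty _),
      fun α hα => absurd hα.1 (Set.notMem_empty _)⟩, fun t => ?_⟩
    cases t with
    | zero =>
      have h1 : {α : Fin 0 →₀ ℕ | mdeg α = 0 ∧ α ∉ (∅ : Set (Fin 0 →₀ ℕ))} = {0} := by
        ext α
        simp [Subsingleton.elim α 0, mdeg]
      rw [hilbC, h1]
      simp [truncPos, hF.1]
    | succ t =>
      have h1 : {α : Fin 0 →₀ ℕ | mdeg α = t + 1 ∧ α ∉ (∅ : Set (Fin 0 →₀ ℕ))} = ∅ := by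
        ext α
        simp [Subsingleton.elim α 0, mdeg]
      rw [hilbC, h1]
      unfold truncPos
      rw [if_neg]
      · simp
      · intro hh
        have := hh 1 (by omega)
        have := hF.2.2.1
        omega
  | succ m ih =>
    obtain ⟨S', hS', hh⟩ := ih
    obtain ⟨h1, h2⟩ := truncPos_step hF m
    apply exists_step S' hS'
    · rw [h1, hh]
    · intro t
      rw [hh]; exact h2 t

/-- For any positive integers `d_1 ≤ … ≤ d_n` there exists a unique almost reverse
lexicographic monomial ideal `J ⊂ K[x_1,…,x_n]` whose quotient has the Hilbert function of a
complete intersection of forms of degrees `d_1,…,d_n`, i.e. the function `H` with generating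
series `Π_{i=1}^n (1 − z^{d_i})/(1 − z)`. -/
theorem exists_unique_almostRevLex_ci {n : ℕ} (d : Fin n → ℕ) (hd : ∀ i, 0 < d i)
    (hmono : Monotone d) (H : ℕ → ℕ)
    (hH : (PowerSeries.mk fun t => (H t : ℤ)) * (1 - PowerSeries.X) ^ n =
      ∏ i : Fin n, (1 - PowerSeries.X ^ d i)) :
    ∃! S : Set (Fin n →₀ ℕ), IsAlmostRevLex S ∧ ∀ t, hilbC S t = H t := by
  obtain ⟨F, hF, hFH, hz⟩ := numeric d hd H hH
  obtain ⟨S, hS, hh⟩ := exists_of_goodFam hF n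
  have hz' : ∀ s t, s ≤ t → H s = 0 → H t = 0 := by
    intro s t hst h0
    induction t, hst using Nat.le_induction with
    | base => exact h0
    | succ t _ ih => exact hz t ih
  have hHt : ∀ t, truncPos (F n) t = H t := by
    intro t
    unfold truncPos
    split_ifs with hc
    · rw [hFH]; simp
    · push Not at hc
      obtain ⟨s, hs, hs'⟩ := hc
      rw [hFH] at hs'
      exact (hz' s t hs (by omega)).symm
  refine ⟨S, ⟨hS, fun t => by rw [hh, hHt]⟩, ?_⟩
  rintro T ⟨hT, hT'⟩
  exact almostRevLex_unique hT hS fun t => by rw [hT', hh, hHt]
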